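/- Assume the smoothness assumptions hold and that for each fixed x, f(x,·) is σ_f-strongly convex. Consider sl-BAMM with μ_k = 0 for all k. Then for every τ > 0 there exist positive constants β̄, η̄, ᾱ such that for step sizes β̄(k+1)^{−τ/2} ≤ β_k ≤ 1/(L_{Fy2}+L_{fy2}), η_k = η̄(k+1)^{−τ/2}β_k, α_k = ᾱ(k+1)^{−τ}β_k, the following holds: if the generated sequence (x_k, y_k) is bounded, then there is a constant C > 0 with min_{0≤k≤K} ‖∇Φ(x_k)‖² ≤ C · K^{−(1−3τ/2)} for all K ≥ 1, where Φ(x) := F(x, y*(x)) and y*(x) is the unique minimizer of f(x,·). -/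

import Mathlib

open Set Filter Asymptotics
open scoped NNReal

noncomputable section

/-- `ℝⁿ` as a Euclidean space. -/
abbrev Eu (n : ℕ) : Type := EuclideanSpace ℝ (Fin n)

variable {n m : ℕ}

/-- Partial gradient with respect to the first (upper-level) variable. -/
def gradx (F : Eu n → Eu m → ℝ) (x : Eu n) (y : Eu m) : Eu n :=
  gradient (fun x' => F x' y) x

/-- Partial gradient with respect to the second (lower-level) variable. -/
def grady (F : Eu n → Eu m → ℝ) (x : Eu n) (y : Eu m) : Eu m :=
  gradient (fun y' => F x y') y

/-- Second-order partial derivative `∇²_{yy}`. -/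
def hessyy (F : Eu n → Eu m → ℝ) (x : Eu n) (y : Eu m) : Eu m →L[ℝ] Eu m :=
  fderiv ℝ (fun y' => grady F x y') y

/-- Mixed second-order partial derivative `∇²_{xy}`, viewed as the linear map
sending a multiplier `v ∈ ℝᵐ` to an element of `ℝⁿ`. -/
def hessxy (F : Eu n → Eu m → ℝ) (x : Eu n) (y : Eu m) : Eu m →L[ℝ] Eu n :=
  ContinuousLinearMap.adjoint (fderiv ℝ (fun x' => grady F x' y) x)

/-- The aggregation function `ψ_μ = μ F + (1-μ) f`. -/
def aggreg (μ : ℝ) (F f : Eu n → Eu m → ℝ) : Eu n → Eu m → ℝ :=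
  fun x y => μ * F x y + (1 - μ) * f x y

/-- The squared KKT residual of the equality-constrained reformulation
`min F(x,y) s.t. ∇_y f(x,y) = 0`. -/
def KKTres (F f : Eu n → Eu m → ℝ) (x : Eu n) (y v : Eu m) : ℝ :=
  ‖gradx F x y - hessxy f x y v‖ ^ 2 + ‖grady F x y - hessyy f x y v‖ ^ 2 +
    ‖grady f x y‖ ^ 2

open InnerProductSpace Topology

section Calculus

variable {E : Type*} [NormedAddCommGroup E] [InnerProductSpace ℝ E]

/-- Second-order Taylor bound for a map with Lipschitz derivative. -/
lemma norm_sub_sub_fderiv_le {G : Type*} [NormedAddCommGroup G] [NormedSpace ℝ G] {g : E → G} (hg : Differentiable ℝ g) {L : ℝ≥0}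
    (hL : LipschitzWith L (fderiv ℝ g)) (a b : E) :
    ‖g b - g a - fderiv ℝ g a (b - a)‖ ≤ L * ‖b - a‖ ^ 2 := by
  have h := (convex_segment (𝕜 := ℝ) a b).norm_image_sub_le_of_norm_fderiv_le' (f := g)
    (φ := fderiv ℝ g a) (C := L * ‖b - a‖) (x := a) (y := b) (fun x _ => hg x)
    (fun x hx => ?_) (left_mem_segment ℝ a b) (right_mem_segment ℝ a b)
  · simpa [pow_two, mul_assoc] using h
  · refine (hL.norm_sub_le x a).trans ?_
    gcongr
    exact norm_sub_le_of_mem_segment hx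

/-- Strong monotonicity passes to the derivative. -/
lemma inner_fderiv_ge_of_strongMono {g : E → E} {y : E} (hg : DifferentiableAt ℝ g y) {σ : ℝ}
    (hmono : ∀ a b, σ * ‖a - b‖ ^ 2 ≤ inner ℝ (g a - g b) (a - b)) (v : E) :
    σ * ‖v‖ ^ 2 ≤ inner ℝ (fderiv ℝ g y v) v := by
  have h1 : HasDerivAt (fun t : ℝ => y + t • v) v 0 := by
    simpa using ((hasDerivAt_id (0 : ℝ)).smul_const v).const_add y
  have hg' : HasFDerivAt g (fderiv ℝ g y) (y + (0 : ℝ) • v) := by simpa using hg.hasFDerivAt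
  have h2 : HasDerivAt (fun t : ℝ => g (y + t • v)) (fderiv ℝ g y v) 0 :=
    hg'.comp_hasDerivAt (0 : ℝ) h1
  have h3 := (hasDerivAt_iff_tendsto_slope_zero.1 h2).mono_left
    (nhdsWithin_mono (0 : ℝ) (s := Ioi 0) fun t (ht : 0 < t) => ht.ne')
  refine ge_of_tendsto (h3.inner (tendsto_const_nhds (x := v))) ?_
  filter_upwards [self_mem_nhdsWithin] with t (ht : 0 < t)
  have h := hmono (y + t • v) y
  simp only [add_sub_cancel_left, norm_smul, Real.norm_of_nonneg ht.le, inner_smul_right] at h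
  simp only [zero_add, zero_smul, add_zero, inner_smul_left, map_inv₀, conj_trivial]
  rw [le_inv_mul_iff₀ ht]
  nlinarith

variable [CompleteSpace E]

lemma lipschitzWith_fderiv_of_gradient {f : E → ℝ} {L : ℝ≥0}
    (hL : LipschitzWith L (gradient f)) : LipschitzWith L (fderiv ℝ f) := by
  rw [← toDual_comp_gradient]
  simpa using (toDual ℝ E).lipschitz.comp hL

/-- Second-order Taylor bound for a function with Lipschitz gradient. -/
lemma abs_sub_sub_inner_gradient_le {f : E → ℝ} (hf : Differentiable ℝ f) {L : ℝ≥0}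
    (hL : LipschitzWith L (gradient f)) (a b : E) :
    |f b - f a - inner ℝ (gradient f a) (b - a)| ≤ L * ‖b - a‖ ^ 2 := by
  simpa [inner_gradient_left] using
    norm_sub_sub_fderiv_le hf (lipschitzWith_fderiv_of_gradient hL) a b

lemma hasDerivAt_comp_add_smul {f : E → ℝ} (hf : Differentiable ℝ f) (a d : E) (t : ℝ) :
    HasDerivAt (fun t : ℝ => f (a + t • d)) (inner ℝ (gradient f (a + t • d)) d) t := by
  have h1 : HasDerivAt (fun t : ℝ => a + t • d) d t := by
    simpa using ((hasDerivAt_id t).smul_const d).const_add a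
  have h2 := (hf (a + t • d)).hasFDerivAt.comp_hasDerivAt t h1
  simpa [inner_gradient_left, Function.comp_def] using h2

/-- The descent lemma, with the sharp constant. -/
lemma descent_lemma {f : E → ℝ} (hf : Differentiable ℝ f) {L : ℝ}
    (hL : ∀ a b, ‖gradient f a - gradient f b‖ ≤ L * ‖a - b‖) (a d : E) :
    f (a + d) ≤ f a + inner ℝ (gradient f a) d + L / 2 * ‖d‖ ^ 2 := by
  let φ : ℝ → ℝ := fun t =>
    f (a + t • d) - t * inner ℝ (gradient f a) d - L / 2 * ‖d‖ ^ 2 * t ^ 2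
  have hφ : ∀ t, HasDerivAt φ (inner ℝ (gradient f (a + t • d)) d - inner ℝ (gradient f a) d
      - L * ‖d‖ ^ 2 * t) t := by
    intro t
    have h := ((hasDerivAt_comp_add_smul hf a d t).sub
      ((hasDerivAt_id t).mul_const (inner ℝ (gradient f a) d))).sub
      ((hasDerivAt_pow 2 t).const_mul (L / 2 * ‖d‖ ^ 2))
    refine h.congr_deriv ?_
    norm_num
    ring
  have hanti : AntitoneOn φ (Icc 0 1) := by
    refine antitoneOn_of_deriv_nonpos (convex_Icc 0 1)
      (fun t _ => (hφ t).continuousAt.continuousWithinAt)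
      (fun t _ => (hφ t).differentiableAt.differentiableWithinAt) fun t ht => ?_
    rw [interior_Icc] at ht
    rw [(hφ t).deriv, ← inner_sub_left]
    have h1 := real_inner_le_norm (gradient f (a + t • d) - gradient f a) d
    have h2 := hL (a + t • d) a
    rw [add_sub_cancel_left, norm_smul, Real.norm_of_nonneg ht.1.le] at h2
    have h3 := mul_le_mul_of_nonneg_right h2 (norm_nonneg d)
    nlinarith
  have := hanti (left_mem_Icc.2 zero_le_one) (right_mem_Icc.2 zero_le_one) zero_le_one
  simp only [φ, one_smul, zero_smul, add_zero] at this
  linarith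

lemma sq_norm_gradient_le {f : E → ℝ} (hf : Differentiable ℝ f) {L : ℝ} (hL0 : 0 < L)
    (hL : ∀ a b, ‖gradient f a - gradient f b‖ ≤ L * ‖a - b‖) {z : E} (hz : ∀ y, f z ≤ f y)
    (y : E) : ‖gradient f y‖ ^ 2 ≤ 2 * L * (f y - f z) := by
  have h := descent_lemma hf hL y (-(1 / L) • gradient f y)
  rw [inner_smul_right, real_inner_self_eq_norm_sq, norm_smul, mul_pow, Real.norm_eq_abs,
    sq_abs] at h
  have h1 := (hz _).trans h
  have h2 : L / 2 * ((-(1 / L)) ^ 2 * ‖gradient f y‖ ^ 2) = 1 / L * ‖gradient f y‖ ^ 2 / 2 := by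
    field_simp
  have h3 : ‖gradient f y‖ ^ 2 = 2 * L * (1 / L * ‖gradient f y‖ ^ 2 / 2) := by
    field_simp
  rw [h3]
  gcongr
  linarith

/-- First-order characterisation of strong convexity. -/
lemma StrongConvexOn.add_inner_gradient_le {f : E → ℝ} (hf : Differentiable ℝ f) {σ : ℝ}
    (hsc : StrongConvexOn univ σ f) (a b : E) :
    f a + inner ℝ (gradient f a) (b - a) + σ / 2 * ‖b - a‖ ^ 2 ≤ f b := by
  have hd := hasDerivAt_comp_add_smul hf a (b - a) 0
  simp only [zero_smul, add_zero] at hd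
  have h1 := (hasDerivAt_iff_tendsto_slope_zero.1 hd).mono_left
    (nhdsWithin_mono (0 : ℝ) (s := Ioi 0) fun t (ht : 0 < t) => ht.ne')
  have h2 : Tendsto (fun t : ℝ => f b - f a - (1 - t) * (σ / 2 * ‖b - a‖ ^ 2)) (𝓝[>] 0)
      (𝓝 (f b - f a - (1 - 0) * (σ / 2 * ‖b - a‖ ^ 2))) := by
    refine (Continuous.tendsto ?_ 0).mono_left nhdsWithin_le_nhds
    fun_prop
  have h3 := le_of_tendsto_of_tendsto h1 h2 ?_
  · linarith
  · filter_upwards [Ioo_mem_nhdsGT (zero_lt_one' ℝ)] with t ht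
    have h := hsc.2 (mem_univ a) (mem_univ b) (sub_nonneg.2 ht.2.le) ht.1.le (by ring)
    have e : (1 - t) • a + t • b = a + t • (b - a) := by module
    rw [e, norm_sub_rev] at h
    simp only [zero_add, zero_smul, add_zero, smul_eq_mul] at h ⊢
    rw [inv_mul_le_iff₀ ht.1]
    nlinarith

lemma StrongConvexOn.inner_gradient_sub_ge {f : E → ℝ} (hf : Differentiable ℝ f) {σ : ℝ}
    (hsc : StrongConvexOn univ σ f) (a b : E) :
    σ * ‖a - b‖ ^ 2 ≤ inner ℝ (gradient f a - gradient f b) (a - b) := by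
  have h1 := hsc.add_inner_gradient_le hf a b
  have h2 := hsc.add_inner_gradient_le hf b a
  rw [norm_sub_rev, ← neg_sub a b, inner_neg_right] at h1
  rw [inner_sub_left]
  linarith

/-- Contraction of a gradient step towards the minimiser. -/
lemma StrongConvexOn.sq_norm_gradient_step_le {f : E → ℝ} (hf : Differentiable ℝ f) {σ : ℝ}
    (hsc : StrongConvexOn univ σ f) {L β : ℝ} (hL0 : 0 < L)
    (hL : ∀ a b, ‖gradient f a - gradient f b‖ ≤ L * ‖a - b‖) (hβ0 : 0 ≤ β) (hβ : β ≤ 1 / L)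
    {z : E} (hz : ∀ y, f z ≤ f y) (y : E) :
    ‖y - β • gradient f y - z‖ ^ 2 ≤ (1 - β * σ) * ‖y - z‖ ^ 2 := by
  have h1 := hsc.add_inner_gradient_le hf y z
  have h2 := sq_norm_gradient_le hf hL0 hL hz y
  rw [norm_sub_rev, ← neg_sub y z, inner_neg_right] at h1
  rw [sub_right_comm, norm_sub_sq_real, inner_smul_right, norm_smul, mul_pow, Real.norm_eq_abs,
    sq_abs, real_inner_comm]
  have h3 : β * L ≤ 1 := by rwa [le_div_iff₀ hL0] at hβ
  have h4 : 0 ≤ β * (1 - β * L) * (f y - f z) :=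
    mul_nonneg (mul_nonneg hβ0 (sub_nonneg.2 h3)) (sub_nonneg.2 (hz y))
  have h5 := mul_le_mul_of_nonneg_left h2 (sq_nonneg β)
  have h6 := mul_le_mul_of_nonneg_left h1 hβ0
  nlinarith

/-- The Riesz isomorphism of a real Hilbert space, as a linear map. -/
def rieszCLM (E : Type*) [NormedAddCommGroup E] [InnerProductSpace ℝ E] [CompleteSpace E] :
    StrongDual ℝ E →L[ℝ] E where
  toFun := (toDual ℝ E).symm
  map_add' := by simp
  map_smul' := by simp
  cont := (toDual ℝ E).symm.continuous

/-- The Hessian of a `C²` function is symmetric. -/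
lemma inner_fderiv_gradient_comm {f : E → ℝ} (hf : ContDiff ℝ 2 f) (y u v : E) :
    inner ℝ (fderiv ℝ (gradient f) y u) v = inner ℝ u (fderiv ℝ (gradient f) y v) := by
  have hd : DifferentiableAt ℝ (fderiv ℝ f) y :=
    (hf.fderiv_right (m := 1) (by norm_num)).differentiable (by norm_num) y
  have key : ∀ w z, inner ℝ (fderiv ℝ (gradient f) y w) z = fderiv ℝ (fderiv ℝ f) y w z := by
    intro w z
    have h : HasFDerivAt (gradient f) ((rieszCLM E).comp (fderiv ℝ (fderiv ℝ f) y)) y :=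
      (rieszCLM E).hasFDerivAt.comp y hd.hasFDerivAt
    rw [h.fderiv]
    exact toDual_symm_apply
  rw [key, real_inner_comm, key]
  exact (hf.contDiffAt.isSymmSndFDerivAt (by simp)) u v

lemma differentiable_gradient {f : E → ℝ} (hf : ContDiff ℝ 2 f) :
    Differentiable ℝ (gradient f) := fun y =>
  (rieszCLM E).differentiableAt.comp y
    ((hf.fderiv_right (m := 1) (by norm_num)).differentiable (by norm_num) y)

end Calculus

section Sequences

/-- A Lyapunov argument for three coupled recursions: when the step sizes separate
asymptotically, the decrease of the potential is summable. -/
lemma exists_sum_le_of_coupled_recursions {Φ e w d p β η α : ℕ → ℝ} {σ A₁ A₂ A₃ A₄ A₅ M : ℝ}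
    (hσ : 0 < σ) (hβ : ∀ k, 0 < β k) (hη : ∀ k, 0 < η k) (hα : ∀ k, 0 < α k)
    (he : ∀ k, 0 ≤ e k) (hw : ∀ k, 0 ≤ w k) (hd : ∀ k, 0 ≤ d k) (hp : ∀ k, 0 ≤ p k)
    (hE : ∀ k, e (k + 1) ≤ (1 - β k * σ / 2) * e k + A₁ * (1 + 1 / β k) * (α k ^ 2 * d k))
    (hW : ∀ᶠ k in atTop, w (k + 1) ≤ (1 - η k * σ / 2) * w k + A₂ * (1 + 1 / η k) *
      (η k ^ 2 * e k) + A₃ * (1 + 1 / η k) * (α k ^ 2 * d k))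
    (hΦ : ∀ k, Φ (k + 1) ≤ Φ k - α k / 2 * p k - α k / 2 * d k + A₄ * α k * (e k + w k)
      + A₅ * (α k ^ 2 * d k))
    (hM : ∀ k, -M ≤ Φ k)
    (tα : Tendsto α atTop (𝓝 0)) (tη : Tendsto η atTop (𝓝 0))
    (tαβ : Tendsto (fun k => α k / β k) atTop (𝓝 0))
    (tαη : Tendsto (fun k => α k / η k) atTop (𝓝 0))
    (tηβ : Tendsto (fun k => η k / β k) atTop (𝓝 0)) :
    ∃ C > (0 : ℝ), ∀ K, ∑ k ∈ Finset.range K, α k * p k ≤ C := by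
  have t1 : Tendsto (fun k => A₁ * (α k + α k / β k) + A₃ * (α k + α k / η k) + A₅ * α k)
      atTop (𝓝 0) := by
    simpa using (((tα.add tαβ).const_mul A₁).add ((tα.add tαη).const_mul A₃)).add
      (tα.const_mul A₅)
  have t2 : Tendsto (fun k => A₂ * ((η k + 1) * (η k / β k)) + A₄ * (α k / β k))
      atTop (𝓝 0) := by
    simpa using (((tη.add_const 1).mul tηβ).const_mul A₂).add (tαβ.const_mul A₄)
  have t3 : Tendsto (fun k => A₄ * (α k / η k)) atTop (𝓝 0) := by
    simpa using tαη.const_mul A₄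
  have hev : ∀ᶠ k in atTop,
      Φ (k + 1) + e (k + 1) + w (k + 1) ≤ Φ k + e k + w k - α k / 2 * p k := by
    filter_upwards [hW, t1.eventually_le_const (by norm_num : (0 : ℝ) < 1 / 2),
      t2.eventually_le_const (half_pos hσ), t3.eventually_le_const (half_pos hσ)]
      with k hk h1 h2 h3
    have b := hβ k
    have c := hη k
    have h1' := mul_le_mul_of_nonneg_left h1 (mul_nonneg (hα k).le (hd k))
    have h2' := mul_le_mul_of_nonneg_left h2 (mul_nonneg b.le (he k))
    have h3' := mul_le_mul_of_nonneg_left h3 (mul_nonneg c.le (hw k))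
    have e1 : α k * d k * (A₁ * (α k + α k / β k) + A₃ * (α k + α k / η k) + A₅ * α k) =
        A₁ * (1 + 1 / β k) * (α k ^ 2 * d k) + A₃ * (1 + 1 / η k) * (α k ^ 2 * d k)
          + A₅ * (α k ^ 2 * d k) := by
      field_simp
    have e2 : β k * e k * (A₂ * ((η k + 1) * (η k / β k)) + A₄ * (α k / β k)) =
        A₂ * (1 + 1 / η k) * (η k ^ 2 * e k) + A₄ * α k * e k := by
      field_simp
    have e3 : η k * w k * (A₄ * (α k / η k)) = A₄ * α k * w k := by
      field_simp
    rw [e1] at h1'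
    rw [e2] at h2'
    rw [e3] at h3'
    linarith [hE k, hΦ k]
  obtain ⟨N, hN⟩ := eventually_atTop.1 hev
  have hsum : ∀ j, ∑ i ∈ Finset.range j, α (N + i) * p (N + i) ≤
      2 * (Φ N + e N + w N - (Φ (N + j) + e (N + j) + w (N + j))) := by
    intro j
    induction j with
    | zero => simp
    | succ j ih =>
      rw [Finset.sum_range_succ]
      have := hN (N + j) (Nat.le_add_right _ _)
      rw [← add_assoc N j 1]
      linarith
  have hnn : ∀ k, 0 ≤ α k * p k := fun k => mul_nonneg (hα k).le (hp k)
  refine ⟨∑ k ∈ Finset.range N, α k * p k + 2 * (Φ N + e N + w N + M) + 1, ?_, fun K => ?_⟩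
  · have := Finset.sum_nonneg fun k (_ : k ∈ Finset.range N) => hnn k
    linarith [hM N, he N, hw N]
  · calc ∑ k ∈ Finset.range K, α k * p k
        ≤ ∑ k ∈ Finset.range (N + K), α k * p k :=
          Finset.sum_le_sum_of_subset_of_nonneg (Finset.range_mono (Nat.le_add_left _ _))
            fun k _ _ => hnn k
      _ = ∑ k ∈ Finset.range N, α k * p k
          + ∑ i ∈ Finset.range K, α (N + i) * p (N + i) := Finset.sum_range_add _ _ _
      _ ≤ _ := by linarith [hsum K, hM (N + K), he (N + K), hw (N + K)]

/-- A weighted sum bound gives a rate for the smallest term. -/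
lemma exists_le_rpow_of_sum_le {α p : ℕ → ℝ} {c C s : ℝ} (hc : 0 < c) (hs : 0 ≤ s)
    (hα : ∀ k : ℕ, c * ((k : ℝ) + 1) ^ (-s) ≤ α k) (hC : 0 < C)
    (h : ∀ K, ∑ k ∈ Finset.range K, α k * p k ≤ C) {K : ℕ} (hK : 1 ≤ K) :
    ∃ k ≤ K, p k ≤ C / c * (K : ℝ) ^ (-(1 - s)) := by
  by_contra! hcon
  have hK0 : (0 : ℝ) < K := by exact_mod_cast hK
  have hlt : ∑ k ∈ Finset.range K, C / K < ∑ k ∈ Finset.range K, α k * p k := by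
    refine Finset.sum_lt_sum_of_nonempty (Finset.nonempty_range_iff.2 (by omega)) fun k hk => ?_
    have hk' : (k : ℝ) + 1 ≤ K := by exact_mod_cast Finset.mem_range.1 hk
    have h1 : c * (K : ℝ) ^ (-s) ≤ α k := le_trans
      (mul_le_mul_of_nonneg_left
        (Real.rpow_le_rpow_of_nonpos (by positivity) hk' (by linarith)) hc.le) (hα k)
    have h2 := hcon k (Finset.mem_range.1 hk).le
    have h3 : (0 : ℝ) < c * (K : ℝ) ^ (-s) := by positivity
    calc C / K = c * (K : ℝ) ^ (-s) * (C / c * (K : ℝ) ^ (-(1 - s))) := by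
          have : (K : ℝ) ^ (-s) * (K : ℝ) ^ (-(1 - s)) = (K : ℝ)⁻¹ := by
            rw [← Real.rpow_add hK0, ← Real.rpow_neg_one]; congr 1; ring
          rw [show c * (K : ℝ) ^ (-s) * (C / c * (K : ℝ) ^ (-(1 - s))) =
            (c * (C / c)) * ((K : ℝ) ^ (-s) * (K : ℝ) ^ (-(1 - s))) by ring, this]
          field_simp
      _ < c * (K : ℝ) ^ (-s) * p k := mul_lt_mul_of_pos_left h2 h3
      _ ≤ α k * p k := mul_le_mul_of_nonneg_right h1 (h2.le.trans' (by positivity))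
  have : ∑ k ∈ Finset.range K, C / (K : ℝ) = C := by
    rw [Finset.sum_const, Finset.card_range, nsmul_eq_mul]; field_simp
  linarith [h K]

end Sequences

section Algebra

variable {E : Type*} [NormedAddCommGroup E] [InnerProductSpace ℝ E]

lemma sq_norm_add_le_of_contraction {a b : E} {s σ W B : ℝ} (hs : 0 < s) (hσ : 0 < σ)
    (hW : 0 ≤ W) (ha : ‖a‖ ^ 2 ≤ (1 - s * σ) * W) (hb : ‖b‖ ^ 2 ≤ B) :
    ‖a + b‖ ^ 2 ≤ (1 - s * σ / 2) * W + (1 + 2 / σ) * (1 + 1 / s) * B := by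
  have hsσ : 0 < s * σ := mul_pos hs hσ
  have h1 : 2 * inner ℝ a b ≤ s * σ / 2 * ‖a‖ ^ 2 + 2 / (s * σ) * ‖b‖ ^ 2 := by
    have h2 := real_inner_le_norm a b
    have h3 : s * σ / 2 * ‖a‖ ^ 2 + 2 / (s * σ) * ‖b‖ ^ 2 - 2 * (‖a‖ * ‖b‖) =
        (s * σ / 2 * ‖a‖ - ‖b‖) ^ 2 * (2 / (s * σ)) := by
      field_simp
      ring
    have h4 : 0 ≤ (s * σ / 2 * ‖a‖ - ‖b‖) ^ 2 * (2 / (s * σ)) := by positivity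
    linarith
  have h5 : (1 + s * σ / 2) * ‖a‖ ^ 2 ≤ (1 - s * σ / 2) * W := by
    have := mul_le_mul_of_nonneg_left ha (by positivity : 0 ≤ 1 + s * σ / 2)
    nlinarith [mul_nonneg (sq_nonneg (s * σ)) hW]
  have h6 : (1 + 2 / (s * σ)) * ‖b‖ ^ 2 ≤ (1 + 2 / σ) * (1 + 1 / s) * B := by
    have h7 : 1 + 2 / (s * σ) ≤ (1 + 2 / σ) * (1 + 1 / s) := by
      have : (1 + 2 / σ) * (1 + 1 / s) = 1 + 2 / (s * σ) + (2 / σ + 1 / s) := by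
        field_simp; ring
      rw [this]
      have : 0 ≤ 2 / σ + 1 / s := by positivity
      linarith
    exact mul_le_mul h7 hb (sq_nonneg _) (by positivity)
  rw [norm_add_sq_real]
  linarith

/-- A small relaxation step for a coercive operator is a contraction. -/
lemma sq_norm_sub_smul_apply_le {T : E →L[ℝ] E} {σ L s : ℝ} (hs : 0 ≤ s)
    (hT : ∀ v, σ * ‖v‖ ^ 2 ≤ inner ℝ (T v) v) (hL : ‖T‖ ≤ L) (hsL : s * L ^ 2 ≤ σ) (w : E) :
    ‖w - s • T w‖ ^ 2 ≤ (1 - s * σ) * ‖w‖ ^ 2 := by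
  rw [norm_sub_sq_real, inner_smul_right, norm_smul, mul_pow, Real.norm_of_nonneg hs,
    real_inner_comm]
  have h1 := mul_le_mul_of_nonneg_left (hT w) hs
  have h2 : ‖T w‖ ^ 2 ≤ L ^ 2 * ‖w‖ ^ 2 := by
    rw [← mul_pow]
    exact pow_le_pow_left₀ (norm_nonneg _) (T.le_of_opNorm_le hL w) 2
  have h3 := mul_le_mul_of_nonneg_left h2 (sq_nonneg s)
  have h4 := mul_le_mul_of_nonneg_right (mul_le_mul_of_nonneg_left hsL hs) (sq_nonneg ‖w‖)
  nlinarith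

lemma mul_norm_le_norm_apply_of_coercive {T : E →L[ℝ] E} {σ : ℝ}
    (hT : ∀ v, σ * ‖v‖ ^ 2 ≤ inner ℝ (T v) v) (v : E) : σ * ‖v‖ ≤ ‖T v‖ := by
  rcases (norm_nonneg v).eq_or_lt with h | h
  · simp [← h]
  · have := (hT v).trans (real_inner_le_norm _ _)
    rw [pow_two, ← mul_assoc] at this
    exact le_of_mul_le_mul_right this h

lemma surjective_of_coercive [FiniteDimensional ℝ E] {T : E →L[ℝ] E} {σ : ℝ} (hσ : 0 < σ)
    (hT : ∀ v, σ * ‖v‖ ^ 2 ≤ inner ℝ (T v) v) : Function.Surjective T := by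
  refine LinearMap.surjective_of_injective (f := (T : E →ₗ[ℝ] E)) ?_
  rw [← LinearMap.ker_eq_bot, LinearMap.ker_eq_bot']
  intro v hv
  have h := mul_norm_le_norm_apply_of_coercive hT v
  have hv' : T v = 0 := hv
  rw [hv', norm_zero] at h
  exact norm_le_zero_iff.1 (nonpos_of_mul_nonpos_right h hσ)

end Algebra

section Bilevel

variable {F f : Eu n → Eu m → ℝ}

lemma contDiff_apply_left (hF : ContDiff ℝ 2 (Function.uncurry F)) (y : Eu m) :
    ContDiff ℝ 2 fun x => F x y :=
  hF.comp (contDiff_id.prodMk contDiff_const)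

lemma contDiff_apply_right (hF : ContDiff ℝ 2 (Function.uncurry F)) (x : Eu n) :
    ContDiff ℝ 2 (F x) :=
  hF.comp (contDiff_const.prodMk contDiff_id)

lemma differentiable_grady_left (hf : ContDiff ℝ 2 (Function.uncurry f)) (y : Eu m) :
    Differentiable ℝ fun x => grady f x y := by
  have hd : Differentiable ℝ (fderiv ℝ (Function.uncurry f)) :=
    (hf.fderiv_right (m := 1) (by norm_num)).differentiable (by norm_num)
  have h : (fun x => grady f x y) = fun x => rieszCLM (Eu m)
      ((fderiv ℝ (Function.uncurry f) (x, y)).comp (ContinuousLinearMap.inr ℝ (Eu n) (Eu m))) := by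
    funext x
    have h1 : HasFDerivAt (f x) ((fderiv ℝ (Function.uncurry f) (x, y)).comp
        (ContinuousLinearMap.inr ℝ (Eu n) (Eu m))) y :=
      ((hf.differentiable (by norm_num)) (x, y)).hasFDerivAt.comp y (hasFDerivAt_prodMk_right x y)
    change (toDual ℝ (Eu m)).symm (fderiv ℝ (f x) y) = _
    rw [h1.fderiv]
    rfl
  rw [h]
  have h2 : Differentiable ℝ fun x : Eu n => fderiv ℝ (Function.uncurry f) (x, y) :=
    hd.comp (differentiable_id.prodMk (differentiable_const y))
  exact (rieszCLM (Eu m)).differentiable.comp (h2.clm_comp (differentiable_const _))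

lemma lipschitzWith_fderiv_grady_left {L : ℝ≥0} {y : Eu m}
    (hL : LipschitzWith L fun x => hessxy f x y) :
    LipschitzWith L (fderiv ℝ fun x => grady f x y) := by
  have h : (fderiv ℝ fun x => grady f x y) =
      (ContinuousLinearMap.adjoint : (Eu m →L[ℝ] Eu n) ≃ₗᵢ⋆[ℝ] (Eu n →L[ℝ] Eu m)) ∘
        fun x => hessxy f x y := by
    funext x
    simp [hessxy]
  rw [h]
  simpa using (ContinuousLinearMap.adjoint :
    (Eu m →L[ℝ] Eu n) ≃ₗᵢ⋆[ℝ] (Eu n →L[ℝ] Eu m)).lipschitz.comp hL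

lemma norm_hessxy_le {L : ℝ≥0} {y : Eu m} (hL : LipschitzWith L fun x => grady f x y) (x : Eu n) :
    ‖hessxy f x y‖ ≤ L := by
  rw [hessxy, LinearIsometryEquiv.norm_map]
  exact norm_fderiv_le_of_lipschitz ℝ hL

lemma norm_hessyy_le {L : ℝ≥0} {x : Eu n} (hL : LipschitzWith L fun y => grady f x y) (y : Eu m) :
    ‖hessyy f x y‖ ≤ L :=
  norm_fderiv_le_of_lipschitz ℝ hL

lemma inner_hessyy_ge (hf : ContDiff ℝ 2 (Function.uncurry f)) {σ : ℝ} {x : Eu n}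
    (hsc : StrongConvexOn univ σ (f x)) (y v : Eu m) :
    σ * ‖v‖ ^ 2 ≤ inner ℝ (hessyy f x y v) v :=
  inner_fderiv_ge_of_strongMono (differentiable_gradient (contDiff_apply_right hf x) y)
    (hsc.inner_gradient_sub_ge ((contDiff_apply_right hf x).differentiable (by norm_num))) v

lemma grady_eq_zero_of_min {x : Eu n} {z : Eu m} (hz : ∀ y, f x z ≤ f x y) :
    grady f x z = 0 := by
  have h : IsLocalMin (f x) z := Eventually.of_forall hz
  rw [grady, gradient, h.fderiv_eq_zero, map_zero]

/-- The lower-level solution map is Lipschitz. -/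
lemma norm_argmin_sub_le (hf : ContDiff ℝ 2 (Function.uncurry f)) {L : ℝ≥0}
    (hL : ∀ y, LipschitzWith L fun x => grady f x y) {σ : ℝ} (hσ : 0 < σ)
    (hsc : ∀ x, StrongConvexOn univ σ (f x)) {ystar : Eu n → Eu m}
    (hmin : ∀ x y, f x (ystar x) ≤ f x y) (x x' : Eu n) :
    ‖ystar x' - ystar x‖ ≤ L / σ * ‖x' - x‖ := by
  have h1 := (hsc x').inner_gradient_sub_ge
    ((contDiff_apply_right hf x').differentiable (by norm_num)) (ystar x') (ystar x)
  have h2 : gradient (f x') (ystar x') = 0 := grady_eq_zero_of_min (hmin x')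
  have h3 : grady f x (ystar x) = 0 := grady_eq_zero_of_min (hmin x)
  have h4 := (hL (ystar x)).norm_sub_le x' x
  rw [h3, sub_zero] at h4
  rw [h2, zero_sub, inner_neg_left] at h1
  have h5 := (neg_le_abs _).trans (abs_real_inner_le_norm (gradient (f x') (ystar x))
    (ystar x' - ystar x))
  rw [div_mul_eq_mul_div, le_div_iff₀ hσ]
  rcases (norm_nonneg (ystar x' - ystar x)).eq_or_lt with h | h
  · rw [← h, zero_mul]; positivity
  · refine le_trans ?_ h4
    refine le_of_mul_le_mul_right ?_ h
    change _ ≤ ‖gradient (f x') (ystar x)‖ * _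
    linarith

/-- Second-order expansion of the hyper-objective around any point. -/
lemma exists_abs_hyperobjective_sub_le
    (hF : ContDiff ℝ 2 (Function.uncurry F)) (hf : ContDiff ℝ 2 (Function.uncurry f))
    {LFx1 LFy1 LFy2 Lfy1 Lfxy1 Lfyy1 Lfyy2 : ℝ≥0}
    (hLFx1 : ∀ y, LipschitzWith LFx1 fun x => gradx F x y)
    (hLFy1 : ∀ y, LipschitzWith LFy1 fun x => grady F x y)
    (hLFy2 : ∀ x, LipschitzWith LFy2 fun y => grady F x y)
    (hLfy1 : ∀ y, LipschitzWith Lfy1 fun x => grady f x y)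
    (hLfxy1 : ∀ y, LipschitzWith Lfxy1 fun x => hessxy f x y)
    (hLfyy1 : ∀ y, LipschitzWith Lfyy1 fun x => hessyy f x y)
    (hLfyy2 : ∀ x, LipschitzWith Lfyy2 fun y => hessyy f x y)
    {σ : ℝ} (hσ : 0 < σ) (hsc : ∀ x, StrongConvexOn univ σ (f x)) {ystar vstar : Eu n → Eu m}
    (hmin : ∀ x y, f x (ystar x) ≤ f x y)
    (hv : ∀ x, hessyy f x (ystar x) (vstar x) = grady F x (ystar x)) :
    ∃ C, 0 ≤ C ∧ ∀ x x', |F x' (ystar x') - F x (ystar x) -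
      inner ℝ (gradx F x (ystar x) - hessxy f x (ystar x) (vstar x)) (x' - x)| ≤
        C * (1 + ‖vstar x‖) * ‖x' - x‖ ^ 2 := by
  set l : ℝ := Lfy1 / σ with hl
  have hl0 : 0 ≤ l := by positivity
  set C₁ : ℝ := LFy2 * l ^ 2 + LFy1 * l + LFx1 with hC₁
  set C₂ : ℝ := Lfyy2 * l ^ 2 + Lfyy1 * l + Lfxy1 with hC₂
  have hC₁0 : 0 ≤ C₁ := by positivity
  have hC₂0 : 0 ≤ C₂ := by positivity
  refine ⟨C₁ + C₂, by positivity, fun x x' => ?_⟩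
  set y := ystar x with hy
  set y' := ystar x' with hy'
  set v := vstar x with hvx
  have hdy : ‖y' - y‖ ≤ l * ‖x' - x‖ := norm_argmin_sub_le hf hLfy1 hσ hsc hmin x x'
  have hdx := norm_nonneg (x' - x)
  have hdy2 : ‖y' - y‖ ^ 2 ≤ l ^ 2 * ‖x' - x‖ ^ 2 := by
    rw [← mul_pow]
    exact pow_le_pow_left₀ (norm_nonneg _) hdy 2
  have hdxy : ‖x' - x‖ * ‖y' - y‖ ≤ l * ‖x' - x‖ ^ 2 := by nlinarith
  have hFd := fun x => (contDiff_apply_right hF x).differentiable (by norm_num)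
  have hFd' := fun y => (contDiff_apply_left hF y).differentiable (by norm_num)
  have t1 := abs_sub_sub_inner_gradient_le (hFd x') (hLFy2 x') y y'
  have t2 : |inner ℝ (grady F x' y - grady F x y) (y' - y)| ≤ LFy1 * ‖x' - x‖ * ‖y' - y‖ :=
    (abs_real_inner_le_norm _ _).trans
      (mul_le_mul_of_nonneg_right ((hLFy1 y).norm_sub_le x' x) (norm_nonneg _))
  have t3 := abs_sub_sub_inner_gradient_le (hFd' y) (hLFx1 y) x x'
  have r1 := norm_sub_sub_fderiv_le (differentiable_gradient (contDiff_apply_right hf x'))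
    (hLfyy2 x') y y'
  have r2 : ‖(hessyy f x' y - hessyy f x y) (y' - y)‖ ≤ Lfyy1 * ‖x' - x‖ * ‖y' - y‖ :=
    ContinuousLinearMap.le_of_opNorm_le _ ((hLfyy1 y).norm_sub_le x' x) _
  have r3 := norm_sub_sub_fderiv_le (differentiable_grady_left hf y)
    (lipschitzWith_fderiv_grady_left (hLfxy1 y)) x x'
  set Dx := fderiv ℝ (fun x => grady f x y) x with hDx
  have hR : ‖hessyy f x y (y' - y) + Dx (x' - x)‖ ≤ C₂ * ‖x' - x‖ ^ 2 := by
    have g1 : grady f x' y' = 0 := grady_eq_zero_of_min (hmin x')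
    have g2 : grady f x y = 0 := grady_eq_zero_of_min (hmin x)
    have e : hessyy f x y (y' - y) + Dx (x' - x) =
        -((grady f x' y' - grady f x' y - hessyy f x' y (y' - y)) +
          (hessyy f x' y - hessyy f x y) (y' - y) +
          (grady f x' y - grady f x y - Dx (x' - x))) := by
      rw [g1, g2, sub_apply]
      abel
    rw [e, norm_neg]
    refine (norm_add₃_le).trans ((add_le_add (add_le_add r1 r2) r3).trans ?_)
    have a1 := mul_le_mul_of_nonneg_left hdy2 Lfyy2.coe_nonneg
    have a2 := mul_le_mul_of_nonneg_left hdxy Lfyy1.coe_nonneg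
    rw [hC₂]
    linarith
  have hsum : inner ℝ (grady F x y) (y' - y) + inner ℝ (hessxy f x y v) (x' - x) =
      inner ℝ v (hessyy f x y (y' - y) + Dx (x' - x)) := by
    rw [inner_add_right, hessxy, ContinuousLinearMap.adjoint_inner_left, ← hv x]
    congr 1
    exact inner_fderiv_gradient_comm (contDiff_apply_right hf x) y v (y' - y)
  have hi := (abs_real_inner_le_norm v (hessyy f x y (y' - y) + Dx (x' - x))).trans
    (mul_le_mul_of_nonneg_left hR (norm_nonneg v))
  rw [← hsum] at hi
  have e : F x' y' - F x y - inner ℝ (gradx F x y - hessxy f x y v) (x' - x) =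
      (F x' y' - F x' y - inner ℝ (grady F x' y) (y' - y)) +
      inner ℝ (grady F x' y - grady F x y) (y' - y) +
      (F x' y - F x y - inner ℝ (gradx F x y) (x' - x)) +
      (inner ℝ (grady F x y) (y' - y) + inner ℝ (hessxy f x y v) (x' - x)) := by
    rw [inner_sub_left, inner_sub_left]
    ring
  rw [e]
  refine (abs_add_le _ _).trans ((add_le_add ((abs_add_three _ _ _).trans
    (add_le_add (add_le_add t1 t2) t3)) hi).trans ?_)
  have a1 := mul_le_mul_of_nonneg_left hdy2 LFy2.coe_nonneg
  have a2 := mul_le_mul_of_nonneg_left hdxy LFy1.coe_nonneg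
  have a3 : 0 ≤ C₁ * ‖v‖ * ‖x' - x‖ ^ 2 := by positivity
  have a4 : 0 ≤ C₂ * ‖x' - x‖ ^ 2 := by positivity
  have a5 : C₁ * ‖x' - x‖ ^ 2 = LFy2 * (l ^ 2 * ‖x' - x‖ ^ 2) + LFy1 * (l * ‖x' - x‖ ^ 2)
    + LFx1 * ‖x' - x‖ ^ 2 := by rw [hC₁]; ring
  linarith

/-- A quadratic expansion identifies the gradient. -/
lemma hasGradientAt_of_abs_sub_le {Φ : Eu n → ℝ} {p x : Eu n} {C : ℝ}
    (h : ∀ x', |Φ x' - Φ x - inner ℝ p (x' - x)| ≤ C * ‖x' - x‖ ^ 2) :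
    HasGradientAt Φ p x := by
  have h1 : (fun x' => Φ x' - Φ x - inner ℝ p (x' - x)) =O[𝓝 x] fun x' => ‖x' - x‖ ^ 2 :=
    IsBigO.of_bound C (Eventually.of_forall fun x' => by simpa using h x')
  have h2 := h1.hasFDerivAt (𝕜 := ℝ) one_lt_two
  rw [hasGradientAt_iff_hasFDerivAt]
  have h3 : HasFDerivAt (fun x' => inner ℝ p (x' - x)) (toDual ℝ (Eu n) p) x := by
    have h := (toDual ℝ (Eu n) p).hasFDerivAt.comp x ((hasFDerivAt_id x).sub_const x)
    rw [ContinuousLinearMap.comp_id] at h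
    exact h
  have h4 := (h2.add h3).add_const (Φ x)
  simpa [Pi.add_def] using h4

end Bilevel

section StepSizes

lemma tendsto_natCast_add_one_rpow_neg {s : ℝ} (hs : 0 < s) :
    Tendsto (fun k : ℕ => ((k : ℝ) + 1) ^ (-s)) atTop (𝓝 0) :=
  (tendsto_rpow_neg_atTop hs).comp (tendsto_atTop_add_const_right _ _ tendsto_natCast_atTop_atTop)

variable {τ βbar ηbar αbar b : ℝ} {β η α : ℕ → ℝ}

lemma tendsto_stepsizes (hτ : 0 < τ) (hηb : 0 < ηbar) (hαb : 0 < αbar)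
    (hβ : ∀ k, 0 < β k) (hβb : ∀ k, β k ≤ b)
    (hη : ∀ k : ℕ, η k = ηbar * ((k : ℝ) + 1) ^ (-(τ / 2)) * β k)
    (hα : ∀ k : ℕ, α k = αbar * ((k : ℝ) + 1) ^ (-τ) * β k) :
    Tendsto α atTop (𝓝 0) ∧ Tendsto η atTop (𝓝 0) ∧
      Tendsto (fun k => α k / β k) atTop (𝓝 0) ∧ Tendsto (fun k => α k / η k) atTop (𝓝 0) ∧
      Tendsto (fun k => η k / β k) atTop (𝓝 0) := by
  have t := tendsto_natCast_add_one_rpow_neg hτ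
  have t' := tendsto_natCast_add_one_rpow_neg (half_pos hτ)
  have hpos : ∀ (k : ℕ) (s : ℝ), 0 < ((k : ℝ) + 1) ^ s := fun k s => by positivity
  refine ⟨?_, ?_, ?_, ?_, ?_⟩
  · refine squeeze_zero (g := fun k : ℕ => αbar * ((k : ℝ) + 1) ^ (-τ) * b) (fun k => ?_)
      (fun k => ?_) (by simpa using (t.const_mul αbar).mul_const b)
    · rw [hα]
      exact (mul_pos (mul_pos hαb (hpos k _)) (hβ k)).le
    · rw [hα]
      exact mul_le_mul_of_nonneg_left (hβb k) (mul_pos hαb (hpos k _)).le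
  · refine squeeze_zero (g := fun k : ℕ => ηbar * ((k : ℝ) + 1) ^ (-(τ / 2)) * b) (fun k => ?_)
      (fun k => ?_) (by simpa using (t'.const_mul ηbar).mul_const b)
    · rw [hη]
      exact (mul_pos (mul_pos hηb (hpos k _)) (hβ k)).le
    · rw [hη]
      exact mul_le_mul_of_nonneg_left (hβb k) (mul_pos hηb (hpos k _)).le
  · have h := t.const_mul αbar
    rw [mul_zero] at h
    refine h.congr fun k => ?_
    rw [hα, mul_div_cancel_right₀ _ (hβ k).ne']
  · have h := t'.const_mul (αbar / ηbar)
    rw [mul_zero] at h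
    refine h.congr fun k => ?_
    have e : ((k : ℝ) + 1) ^ (-τ) = ((k : ℝ) + 1) ^ (-(τ / 2)) * ((k : ℝ) + 1) ^ (-(τ / 2)) := by
      rw [← Real.rpow_add (by positivity)]; congr 1; ring
    have h1 := (hβ k).ne'
    have h2 := (hpos k (-(τ / 2))).ne'
    rw [hα, hη, e]
    field_simp
  · have h := t'.const_mul ηbar
    rw [mul_zero] at h
    refine h.congr fun k => ?_
    rw [hη, mul_div_cancel_right₀ _ (hβ k).ne']

end StepSizes

/-- Convergence rate of sl-BAMM with `μ_k = 0`, for arbitrary positive step-size constants. -/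
theorem slBAMM_rate
    {F f : Eu n → Eu m → ℝ}
    (hF : ContDiff ℝ 2 (Function.uncurry F))
    (hf : ContDiff ℝ 2 (Function.uncurry f))
    {LFx1 LFx2 LFy1 LFy2 Lfy1 Lfy2 Lfxy1 Lfxy2 Lfyy1 Lfyy2 : ℝ≥0}
    (hLFx1 : ∀ y, LipschitzWith LFx1 fun x => gradx F x y)
    (hLFx2 : ∀ x, LipschitzWith LFx2 fun y => gradx F x y)
    (hLFy1 : ∀ y, LipschitzWith LFy1 fun x => grady F x y)
    (hLFy2 : ∀ x, LipschitzWith LFy2 fun y => grady F x y)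
    (hLfy1 : ∀ y, LipschitzWith Lfy1 fun x => grady f x y)
    (hLfy2 : ∀ x, LipschitzWith Lfy2 fun y => grady f x y)
    (hLfxy1 : ∀ y, LipschitzWith Lfxy1 fun x => hessxy f x y)
    (hLfxy2 : ∀ x, LipschitzWith Lfxy2 fun y => hessxy f x y)
    (hLfyy1 : ∀ y, LipschitzWith Lfyy1 fun x => hessyy f x y)
    (hLfyy2 : ∀ x, LipschitzWith Lfyy2 fun y => hessyy f x y)
    {σ : ℝ} (hσ : 0 < σ)
    (hsc : ∀ x, StrongConvexOn univ σ (f x))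
    {ystar : Eu n → Eu m}
    (hmin : ∀ x y, f x (ystar x) ≤ f x y)
    {τ βbar ηbar αbar L : ℝ} (hτ : 0 < τ) (hβb : 0 < βbar) (hηb : 0 < ηbar) (hαb : 0 < αbar)
    (hLL : (Lfy2 : ℝ) ≤ L)
    {β η α : ℕ → ℝ} {x : ℕ → Eu n} {y v : ℕ → Eu m}
    (hβ : ∀ k : ℕ, βbar * ((k : ℝ) + 1) ^ (-(τ / 2)) ≤ β k ∧ β k ≤ 1 / L)
    (hη : ∀ k : ℕ, η k = ηbar * ((k : ℝ) + 1) ^ (-(τ / 2)) * β k)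
    (hα : ∀ k : ℕ, α k = αbar * ((k : ℝ) + 1) ^ (-τ) * β k)
    (hy : ∀ k, y (k + 1) = y k - β k • grady f (x k) (y k))
    (hv : ∀ k, v (k + 1) = v k + η k •
      (grady F (x k) (y k) - hessyy f (x k) (y k) (v k)))
    (hx : ∀ k, x (k + 1) = x k - α k •
      (gradx F (x k) (y k) - hessxy f (x k) (y k) (v k)))
    {D : ℝ} (hD : ∀ k, ‖x k‖ ≤ D) :
    ∃ C > (0 : ℝ), ∀ K : ℕ, 1 ≤ K → ∃ k ≤ K,
      ‖gradient (fun x' => F x' (ystar x')) (x k)‖ ^ 2 ≤ C * (K : ℝ) ^ (-(1 - 3 * τ / 2)) := by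
  have hβ0 : ∀ k, 0 < β k := fun k => lt_of_lt_of_le (by positivity) (hβ k).1
  have hη0 : ∀ k, 0 < η k := fun k => by
    have := hβ0 k
    rw [hη]; positivity
  have hα0 : ∀ k, 0 < α k := fun k => by
    have := hβ0 k
    rw [hα]; positivity
  have hL0 : 0 < L := one_div_pos.1 ((hβ0 0).trans_le (hβ 0).2)
  have hD0 : 0 ≤ D := (norm_nonneg _).trans (hD 0)
  obtain ⟨tα, tη, tαβ, tαη, tηβ⟩ :=
    tendsto_stepsizes hτ hηb hαb hβ0 (fun k => (hβ k).2) hη hα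
  have hH := fun x y v => inner_hessyy_ge hf (hsc x) y v
  choose vstar hvs using fun x => surjective_of_coercive hσ (hH x (ystar x)) (grady F x (ystar x))
  set l : ℝ := Lfy1 / σ with hl
  have hl0 : 0 ≤ l := by positivity
  have hys : ∀ x x', ‖ystar x' - ystar x‖ ≤ l * ‖x' - x‖ := norm_argmin_sub_le hf hLfy1 hσ hsc hmin
  obtain ⟨C₀, hC₀, hexp⟩ := exists_abs_hyperobjective_sub_le hF hf hLFx1 hLFy1 hLFy2 hLfy1 hLfxy1
    hLfyy1 hLfyy2 hσ hsc hmin hvs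
  set Φ : Eu n → ℝ := fun x => F x (ystar x) with hΦ
  set P : Eu n → Eu n := fun x => gradx F x (ystar x) - hessxy f x (ystar x) (vstar x) with hP
  have hgrad : ∀ x, HasGradientAt Φ (P x) x := fun x => hasGradientAt_of_abs_sub_le (hexp x)
  obtain ⟨M₀, hM₀⟩ : ∃ M, ∀ k, |Φ (x k)| ≤ M := by
    have hc : Continuous Φ := continuous_iff_continuousAt.2 fun z => (hgrad z).continuousAt
    obtain ⟨M, hM⟩ := (isCompact_closedBall (0 : Eu n) D).exists_bound_of_continuousOn
      hc.continuousOn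
    exact ⟨M, fun k => hM _ (by simpa using hD k)⟩
  -- Lipschitz dependence of the lower-level data on the upper variable
  have hb : ∀ x x', ‖grady F x' (ystar x') - grady F x (ystar x)‖ ≤
      (LFy1 + LFy2 * l) * ‖x' - x‖ := by
    intro x x'
    have h1 := (hLFy1 (ystar x')).norm_sub_le x' x
    have h2 := (hLFy2 x).norm_sub_le (ystar x') (ystar x)
    have h3 := mul_le_mul_of_nonneg_left (hys x x') LFy2.coe_nonneg
    have h4 := norm_sub_le_norm_sub_add_norm_sub (grady F x' (ystar x')) (grady F x (ystar x'))
      (grady F x (ystar x))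
    linarith
  have hHl : ∀ x x', ‖hessyy f x' (ystar x') - hessyy f x (ystar x)‖ ≤
      (Lfyy1 + Lfyy2 * l) * ‖x' - x‖ := by
    intro x x'
    have h1 := (hLfyy1 (ystar x')).norm_sub_le x' x
    have h2 := (hLfyy2 x).norm_sub_le (ystar x') (ystar x)
    have h3 := mul_le_mul_of_nonneg_left (hys x x') Lfyy2.coe_nonneg
    have h4 := norm_sub_le_norm_sub_add_norm_sub (hessyy f x' (ystar x')) (hessyy f x (ystar x'))
      (hessyy f x (ystar x))
    linarith
  obtain ⟨M, hM0, hM⟩ : ∃ M, 0 ≤ M ∧ ∀ k, ‖vstar (x k)‖ ≤ M := by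
    refine ⟨(‖grady F 0 (ystar 0)‖ + (LFy1 + LFy2 * l) * D) / σ, by positivity, fun k => ?_⟩
    rw [le_div_iff₀ hσ, mul_comm]
    refine (mul_norm_le_norm_apply_of_coercive (hH (x k) (ystar (x k))) _).trans ?_
    rw [hvs]
    have h1 := hb 0 (x k)
    rw [sub_zero] at h1
    have h2 := norm_le_norm_add_norm_sub (grady F 0 (ystar 0)) (grady F (x k) (ystar (x k)))
    rw [norm_sub_rev] at h2
    have h3 := mul_le_mul_of_nonneg_left (hD k) (by positivity : 0 ≤ (LFy1 : ℝ) + LFy2 * l)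
    linarith
  obtain ⟨lv, hlv0, hlv⟩ : ∃ lv, 0 ≤ lv ∧ ∀ k z, ‖vstar z - vstar (x k)‖ ≤ lv * ‖z - x k‖ := by
    refine ⟨((LFy1 + LFy2 * l) + (Lfyy1 + Lfyy2 * l) * M) / σ, by positivity, fun k z => ?_⟩
    rw [div_mul_eq_mul_div, le_div_iff₀ hσ, mul_comm]
    refine (mul_norm_le_norm_apply_of_coercive (hH z (ystar z)) _).trans ?_
    have e : hessyy f z (ystar z) (vstar z - vstar (x k)) =
        (grady F z (ystar z) - grady F (x k) (ystar (x k))) -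
          (hessyy f z (ystar z) - hessyy f (x k) (ystar (x k))) (vstar (x k)) := by
      rw [map_sub, sub_apply, hvs, hvs]
      abel
    rw [e]
    refine (norm_sub_le _ _).trans ((add_le_add (hb (x k) z)
      (ContinuousLinearMap.le_of_opNorm_le_of_le _ (hHl (x k) z) (hM k))).trans_eq ?_)
    ring
  -- the three coupled recursions
  set d : ℕ → Eu n := fun k => gradx F (x k) (y k) - hessxy f (x k) (y k) (v k) with hd
  have hxd : ∀ k, ‖x (k + 1) - x k‖ ^ 2 = α k ^ 2 * ‖d k‖ ^ 2 := fun k => by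
    rw [hx, sub_sub_cancel_left, norm_neg, norm_smul, mul_pow, Real.norm_eq_abs, sq_abs]
  set e : ℕ → ℝ := fun k => ‖y k - ystar (x k)‖ ^ 2 with he
  set w : ℕ → ℝ := fun k => ‖v k - vstar (x k)‖ ^ 2 with hw
  have hE : ∀ k, e (k + 1) ≤ (1 - β k * σ / 2) * e k +
      (1 + 2 / σ) * l ^ 2 * (1 + 1 / β k) * (α k ^ 2 * ‖d k‖ ^ 2) := by
    intro k
    have h1 := (hsc (x k)).sq_norm_gradient_step_le
      ((contDiff_apply_right hf (x k)).differentiable (by norm_num)) hL0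
      (fun a b => ((hLfy2 (x k)).norm_sub_le a b).trans
        (mul_le_mul_of_nonneg_right hLL (norm_nonneg _))) (hβ0 k).le (hβ k).2 (hmin (x k)) (y k)
    have h2 : ‖ystar (x k) - ystar (x (k + 1))‖ ^ 2 ≤ l ^ 2 * (α k ^ 2 * ‖d k‖ ^ 2) := by
      rw [← hxd, ← mul_pow, norm_sub_rev]
      exact pow_le_pow_left₀ (norm_nonneg _) (hys _ _) 2
    have h3 := sq_norm_add_le_of_contraction (hβ0 k) hσ (sq_nonneg _) h1 h2
    rw [sub_add_sub_cancel] at h3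
    simp only [he, hy k]
    exact h3.trans_eq (by ring)
  set B : ℝ := LFy2 + Lfyy2 * M with hB
  have hB0 : 0 ≤ B := by positivity
  have hW : ∀ᶠ k in atTop, w (k + 1) ≤ (1 - η k * σ / 2) * w k +
      (1 + 2 / σ) * (2 * B ^ 2) * (1 + 1 / η k) * (η k ^ 2 * e k) +
      (1 + 2 / σ) * (2 * lv ^ 2) * (1 + 1 / η k) * (α k ^ 2 * ‖d k‖ ^ 2) := by
    have tη' : Tendsto (fun k => η k * L ^ 2) atTop (𝓝 0) := by simpa using tη.mul_const (L ^ 2)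
    filter_upwards [tη'.eventually_le_const hσ] with k hk
    have h1 := sq_norm_sub_smul_apply_le (hη0 k).le (hH (x k) (y k))
      ((norm_hessyy_le (hLfy2 (x k)) (y k)).trans hLL) hk (v k - vstar (x k))
    set r := grady F (x k) (y k) - hessyy f (x k) (y k) (vstar (x k)) with hr
    have hr' : ‖r‖ ≤ B * ‖y k - ystar (x k)‖ := by
      have e1 : r = (grady F (x k) (y k) - grady F (x k) (ystar (x k))) -
          (hessyy f (x k) (y k) - hessyy f (x k) (ystar (x k))) (vstar (x k)) := by
        rw [hr, sub_apply, hvs]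
        abel
      rw [e1]
      refine (norm_sub_le _ _).trans ((add_le_add ((hLFy2 (x k)).norm_sub_le _ _)
        (ContinuousLinearMap.le_of_opNorm_le_of_le _ ((hLfyy2 (x k)).norm_sub_le _ _)
          (hM k))).trans_eq ?_)
      rw [hB]
      ring
    have h2 : ‖η k • r - (vstar (x (k + 1)) - vstar (x k))‖ ^ 2 ≤
        2 * B ^ 2 * (η k ^ 2 * e k) + 2 * lv ^ 2 * (α k ^ 2 * ‖d k‖ ^ 2) := by
      have n1 : ‖η k • r‖ ^ 2 ≤ B ^ 2 * (η k ^ 2 * e k) := by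
        rw [norm_smul, Real.norm_of_nonneg (hη0 k).le]
        calc (η k * ‖r‖) ^ 2 ≤ (η k * (B * ‖y k - ystar (x k)‖)) ^ 2 := by
              have := (hη0 k).le
              gcongr
          _ = _ := by rw [he]; ring
      have n2 : ‖vstar (x (k + 1)) - vstar (x k)‖ ^ 2 ≤ lv ^ 2 * (α k ^ 2 * ‖d k‖ ^ 2) := by
        rw [← hxd, ← mul_pow]
        exact pow_le_pow_left₀ (norm_nonneg _) (hlv _ _) 2
      have n3 := pow_le_pow_left₀ (norm_nonneg _)
        (norm_sub_le (η k • r) (vstar (x (k + 1)) - vstar (x k))) 2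
      have n4 := add_sq_le (a := ‖η k • r‖) (b := ‖vstar (x (k + 1)) - vstar (x k)‖)
      linarith
    have h3 := sq_norm_add_le_of_contraction (hη0 k) hσ (sq_nonneg _) h1 h2
    have e2 : v k - vstar (x k) - η k • hessyy f (x k) (y k) (v k - vstar (x k)) +
        (η k • r - (vstar (x (k + 1)) - vstar (x k))) = v (k + 1) - vstar (x (k + 1)) := by
      rw [hv k, hr, map_sub]
      module
    rw [e2] at h3
    exact h3.trans_eq (by ring)
  set A : ℝ := LFx2 + Lfxy2 * M + Lfy1 with hA
  have hA0 : 0 ≤ A := by positivity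
  have hdP : ∀ k, ‖d k - P (x k)‖ ^ 2 ≤ 2 * A ^ 2 * (e k + w k) := by
    intro k
    have e1 : d k - P (x k) = (gradx F (x k) (y k) - gradx F (x k) (ystar (x k))) -
        (hessxy f (x k) (y k) - hessxy f (x k) (ystar (x k))) (vstar (x k)) -
        hessxy f (x k) (y k) (v k - vstar (x k)) := by
      simp only [hd, hP, map_sub, sub_apply]
      abel
    have h1 : ‖d k - P (x k)‖ ≤ A * (‖y k - ystar (x k)‖ + ‖v k - vstar (x k)‖) := by
      rw [e1]
      refine (norm_sub_le _ _).trans ((add_le_add ((norm_sub_le _ _).trans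
        (add_le_add ((hLFx2 (x k)).norm_sub_le _ _) (ContinuousLinearMap.le_of_opNorm_le_of_le _
          ((hLfxy2 (x k)).norm_sub_le _ _) (hM k)))) (ContinuousLinearMap.le_of_opNorm_le _
          (norm_hessxy_le (hLfy1 (y k)) (x k)) _)).trans ?_)
      have a1 : 0 ≤ (Lfy1 : ℝ) * ‖y k - ystar (x k)‖ := by positivity
      have a2 : 0 ≤ ((LFx2 : ℝ) + Lfxy2 * M) * ‖v k - vstar (x k)‖ := by positivity
      rw [hA]
      linarith
    refine (pow_le_pow_left₀ (norm_nonneg _) h1 2).trans ?_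
    have h2 := mul_le_mul_of_nonneg_left
      (add_sq_le (a := ‖y k - ystar (x k)‖) (b := ‖v k - vstar (x k)‖)) (sq_nonneg A)
    rw [mul_pow]
    exact h2.trans_eq (by simp only [he, hw]; ring)
  have hΦstep : ∀ k, Φ (x (k + 1)) ≤ Φ (x k) - α k / 2 * ‖P (x k)‖ ^ 2 - α k / 2 * ‖d k‖ ^ 2
      + A ^ 2 * α k * (e k + w k) + C₀ * (1 + M) * (α k ^ 2 * ‖d k‖ ^ 2) := by
    intro k
    have h1 := (le_abs_self _).trans (hexp (x k) (x (k + 1)))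
    have h2 : C₀ * (1 + ‖vstar (x k)‖) * ‖x (k + 1) - x k‖ ^ 2 ≤
        C₀ * (1 + M) * (α k ^ 2 * ‖d k‖ ^ 2) := by
      rw [hxd]
      have := hM k
      gcongr
    have h3 : inner ℝ (P (x k)) (x (k + 1) - x k) = -(α k * inner ℝ (d k) (P (x k))) := by
      rw [hx, sub_sub_cancel_left, inner_neg_right, inner_smul_right, real_inner_comm]
    have h4 := mul_le_mul_of_nonneg_left (hdP k) (half_pos (hα0 k)).le
    rw [norm_sub_sq_real] at h4
    change Φ (x (k + 1)) - Φ (x k) - inner ℝ (P (x k)) (x (k + 1) - x k) ≤ _ at h1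
    rw [h3] at h1
    linarith
  obtain ⟨C, hC, hsum⟩ := exists_sum_le_of_coupled_recursions (Φ := fun k => Φ (x k))
    (p := fun k => ‖P (x k)‖ ^ 2) hσ hβ0 hη0 hα0
    (fun k => sq_nonneg _) (fun k => sq_nonneg _) (fun k => sq_nonneg _) (fun k => sq_nonneg _)
    hE hW hΦstep (fun k => (abs_le.1 (hM₀ k)).1) tα tη tαβ tαη tηβ
  have hαlow : ∀ k : ℕ, αbar * βbar * ((k : ℝ) + 1) ^ (-(3 * τ / 2)) ≤ α k := by
    intro k
    have e1 : ((k : ℝ) + 1) ^ (-(3 * τ / 2)) =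
        ((k : ℝ) + 1) ^ (-τ) * ((k : ℝ) + 1) ^ (-(τ / 2)) := by
      rw [← Real.rpow_add (by positivity)]; congr 1; ring
    rw [hα, e1]
    calc αbar * βbar * (((k : ℝ) + 1) ^ (-τ) * ((k : ℝ) + 1) ^ (-(τ / 2)))
        = αbar * ((k : ℝ) + 1) ^ (-τ) * (βbar * ((k : ℝ) + 1) ^ (-(τ / 2))) := by ring
      _ ≤ _ := mul_le_mul_of_nonneg_left (hβ k).1 (by positivity)
  refine ⟨C / (αbar * βbar), by positivity, fun K hK => ?_⟩
  obtain ⟨k, hk, hle⟩ := exists_le_rpow_of_sum_le (mul_pos hαb hβb) (by positivity) hαlow hC hsum hK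
  exact ⟨k, hk, by rwa [(hgrad (x k)).gradient]⟩

/-- Theorem 3.10: convergence rate of sl-BAMM in the
lower-level strongly convex case (`μ_k = 0`). -/
theorem slBAMM_convergence_strongly_convex {n m : ℕ}
    (F f : Eu n → Eu m → ℝ)
    (hF : ContDiff ℝ 2 (Function.uncurry F))
    (hf : ContDiff ℝ 2 (Function.uncurry f))
    (LFx1 LFx2 LFy1 LFy2 Lfy1 Lfy2 Lfxy1 Lfxy2 Lfyy1 Lfyy2 : ℝ≥0)
    (hLFx1 : ∀ y, LipschitzWith LFx1 fun x => gradx F x y)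
    (hLFx2 : ∀ x, LipschitzWith LFx2 fun y => gradx F x y)
    (hLFy1 : ∀ y, LipschitzWith LFy1 fun x => grady F x y)
    (hLFy2 : ∀ x, LipschitzWith LFy2 fun y => grady F x y)
    (hLfy1 : ∀ y, LipschitzWith Lfy1 fun x => grady f x y)
    (hLfy2 : ∀ x, LipschitzWith Lfy2 fun y => grady f x y)
    (hLfxy1 : ∀ y, LipschitzWith Lfxy1 fun x => hessxy f x y)
    (hLfxy2 : ∀ x, LipschitzWith Lfxy2 fun y => hessxy f x y)
    (hLfyy1 : ∀ y, LipschitzWith Lfyy1 fun x => hessyy f x y)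
    (hLfyy2 : ∀ x, LipschitzWith Lfyy2 fun y => hessyy f x y)
    (σf : ℝ) (hσf : 0 < σf)
    (hfsc : ∀ x, StrongConvexOn univ σf (f x))
    (ystar : Eu n → Eu m)
    (hmin : ∀ x y, f x (ystar x) ≤ f x y) :
    ∀ τ : ℝ, 0 < τ →
      ∃ βbar ηbar αbar : ℝ, 0 < βbar ∧ 0 < ηbar ∧ 0 < αbar ∧
        ∀ (β η α : ℕ → ℝ) (x : ℕ → Eu n) (y v : ℕ → Eu m),
          (∀ k : ℕ, βbar * ((k : ℝ) + 1) ^ (-(τ / 2)) ≤ β k ∧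
            β k ≤ 1 / ((LFy2 : ℝ) + (Lfy2 : ℝ))) →
          (∀ k : ℕ, η k = ηbar * ((k : ℝ) + 1) ^ (-(τ / 2)) * β k) →
          (∀ k : ℕ, α k = αbar * ((k : ℝ) + 1) ^ (-τ) * β k) →
          (∀ k, y (k + 1) = y k - β k • grady f (x k) (y k)) →
          (∀ k, v (k + 1) = v k + η k •
            (grady F (x k) (y k) - hessyy f (x k) (y k) (v k))) →
          (∀ k, x (k + 1) = x k - α k •
            (gradx F (x k) (y k) - hessxy f (x k) (y k) (v k))) →
          (∃ D : ℝ, ∀ k, ‖x k‖ + ‖y k‖ ≤ D) →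
          ∃ C > (0 : ℝ), ∀ K : ℕ, 1 ≤ K → ∃ k ≤ K,
            ‖gradient (fun x' => F x' (ystar x')) (x k)‖ ^ 2 ≤
              C * (K : ℝ) ^ (-(1 - 3 * τ / 2)) := by
  intro τ hτ
  have hpos : 0 < 1 / ((LFy2 : ℝ) + Lfy2 + 1) := by positivity
  refine ⟨1 / ((LFy2 : ℝ) + Lfy2 + 1), 1, 1, hpos, one_pos, one_pos, ?_⟩
  rintro β η α x y v hβ hη hα hy hv hx ⟨D, hD⟩
  exact slBAMM_rate hF hf hLFx1 hLFx2 hLFy1 hLFy2 hLfy1 hLfy2 hLfxy1 hLfxy2 hLfyy1 hLfyy2 hσf hfsc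
    hmin hτ hpos one_pos one_pos (le_add_of_nonneg_left LFy2.coe_nonneg) hβ hη hα hy hv hx
    fun k => (le_add_of_nonneg_right (norm_nonneg _)).trans (hD k)
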